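/- Fix any μ ∈ (0,1) and any bounded sets B_p, B_q ⊂ ℝ. Then, uniformly with respect to α̃ ∈ ε^{−1/2}(−a,a), p̂ ∈ B_p, q ∈ B_q, and ε > 0 sufficiently small: (i) Ψ_l(α̃ + Δα̃, p̂, q) − Ψ_l(α̃, p̂, q) = O(|Δα̃|^γ) as Δα̃ → 0; (ii) Ψ_l(α̃, p̂ + Δp̂, q) − Ψ_l(α̃, p̂, q) = O(|Δp̂|^μ) as Δp̂ → 0; (iii) Ψ_l(α̃, p̂, q + Δq) − Ψ_l(α̃, p̂, q) = O(|Δq|) as Δq → 0. -/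

import Mathlib

open MeasureTheory Filter Topology

/-- A function that is differentiable everywhere, with almost everywhere bounded derivative,
is Lipschitz. -/
theorem abs_sub_le_of_ae_abs_deriv_le {f : ℝ → ℝ} {M : ℝ} (hf : Differentiable ℝ f)
    (hM : ∀ᵐ p : ℝ, |deriv f p| ≤ M) (x y : ℝ) : |f x - f y| ≤ M * |x - y| := by
  have hint : IntervalIntegrable (deriv f) volume y x :=
    (intervalIntegrable_const (c := M)).mono_fun (measurable_deriv f).aestronglyMeasurable
      (ae_restrict_of_ae (hM.mono fun p hp => by
        simpa using hp.trans (le_abs_self M)))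
  rw [← intervalIntegral.integral_eq_sub_of_hasDerivAt
    (fun p _ => (hf p).hasDerivAt) hint]
  exact intervalIntegral.norm_integral_le_of_norm_le_const_ae
    (f := deriv f) (hM.mono fun p hp _ => hp)

/-- The Hilbert kernel `1 / u`, truncated to `|u| > δ`. -/
noncomputable def truncInv (δ u : ℝ) : ℝ := {u : ℝ | δ < |u|}.indicator (fun u => u⁻¹) u

theorem truncInv_neg (δ u : ℝ) : truncInv δ (-u) = -truncInv δ u := by
  by_cases h : δ < |u| <;> simp [truncInv, Set.indicator, h, inv_neg]

theorem abs_truncInv_le (δ u : ℝ) : |truncInv δ u| ≤ |u|⁻¹ := by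
  by_cases h : δ < |u| <;> simp [truncInv, Set.indicator, h, abs_inv]

theorem abs_truncInv_le_inv {δ : ℝ} (hδ : 0 < δ) (u : ℝ) : |truncInv δ u| ≤ δ⁻¹ := by
  by_cases h : δ < |u|
  · simpa [truncInv, Set.indicator, h, abs_inv] using inv_anti₀ hδ h.le
  · simp [truncInv, Set.indicator, h, hδ.le]

theorem measurableSet_lt_abs (δ : ℝ) : MeasurableSet {u : ℝ | δ < |u|} :=
  measurableSet_lt measurable_const measurable_norm

theorem measurable_truncInv (δ : ℝ) : Measurable (truncInv δ) :=
  measurable_inv.indicator (measurableSet_lt_abs δ)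

theorem integrable_truncInv_mul {f : ℝ → ℝ} (hf : Integrable f) {δ : ℝ} (hδ : 0 < δ) :
    Integrable (fun u => truncInv δ u * f u) :=
  hf.bdd_mul (measurable_truncInv δ).aestronglyMeasurable
    (ae_of_all _ fun u => abs_truncInv_le_inv hδ u)

theorem two_mul_truncated_integral {f : ℝ → ℝ} (hf : Integrable f) {δ : ℝ} (hδ : 0 < δ) (t : ℝ) :
    2 * ∫ s in {s : ℝ | δ < |t - s|}, f s / (t - s) =
      ∫ u, truncInv δ u * (f (t - u) - f (t + u)) := by
  have hm : MeasurableSet {s : ℝ | δ < |t - s|} :=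
    (measurableSet_lt_abs δ).preimage (measurable_const.sub measurable_id)
  have h1 : ∫ s in {s : ℝ | δ < |t - s|}, f s / (t - s) = ∫ u, truncInv δ u * f (t - u) := by
    rw [← integral_indicator hm, ← integral_sub_left_eq_self _ volume t]
    congr 1 with s
    by_cases h : δ < |s| <;> simp [truncInv, Set.indicator, h, div_eq_inv_mul]
  have h2 : ∫ u, truncInv δ u * f (t - u) = ∫ u, -(truncInv δ u * f (t + u)) := by
    rw [← integral_neg_eq_self]
    simp [truncInv_neg]
  have i1 := integrable_truncInv_mul (hf.comp_sub_left t) hδ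
  have i2 := integrable_truncInv_mul (hf.comp_add_left t) hδ
  calc _ = (∫ u, truncInv δ u * f (t - u)) + ∫ u, -(truncInv δ u * f (t + u)) := by
        rw [h1, ← h2]; ring
    _ = _ := by
        rw [← integral_add i1 i2.fun_neg]
        congr 1 with u
        ring

theorem integrableOn_abs_rpow_neg {μ : ℝ} (hμ : μ < 1) (R : ℝ) :
    IntegrableOn (fun u : ℝ => |u| ^ (-μ)) (Set.Icc (-R) R) := by
  have h0 : IntegrableOn (fun u : ℝ => |u| ^ (-μ)) (Set.Ioc 0 R) := by
    have h := (intervalIntegral.intervalIntegrable_rpow' (a := 0) (b := R)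
      (show -1 < -μ by linarith)).1
    exact h.congr_fun (fun u hu => by simp [abs_of_pos hu.1]) measurableSet_Ioc
  have h1 : IntegrableOn (fun u : ℝ => |u| ^ (-μ)) (Set.Icc 0 R) :=
    (integrableOn_Icc_iff_integrableOn_Ioc).2 h0
  have h2 : IntegrableOn (fun u : ℝ => |u| ^ (-μ)) (Set.Icc (-R) 0) := by
    have := h1.comp_neg
    simpa using this
  refine (h2.union h1).mono_set fun u hu => ?_
  rcases le_total u 0 with h | h
  · exact Or.inl ⟨hu.1, h⟩
  · exact Or.inr ⟨h, hu.2⟩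

theorem min_one_le_rpow {r μ : ℝ} (hr : 0 ≤ r) (h0 : 0 ≤ μ) (h1 : μ ≤ 1) : min 1 r ≤ r ^ μ := by
  rcases le_total r 1 with h | h
  · exact (min_le_right _ _).trans (Real.self_le_rpow_of_le_one hr h h1)
  · exact (min_le_left _ _).trans (Real.one_le_rpow h h0)

theorem abs_truncated_integral_le {f : ℝ → ℝ} {K L T δ t : ℝ} (hf : Integrable f)
    (hK : ∀ x y, |f x - f y| ≤ K * |x - y|) (hL : ∀ x, L < |x| → f x = 0)
    (hδ : 0 < δ) (hT0 : 0 ≤ L + T) (ht : |t| ≤ T) :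
    |∫ s in {s : ℝ | δ < |t - s|}, f s / (t - s)| ≤ 2 * K * (L + T) := by
  have hb : ∀ u ∈ Set.Icc (-(L + T)) (L + T),
      ‖truncInv δ u * (f (t - u) - f (t + u))‖ ≤ 2 * K := fun u _ => by
    rw [Real.norm_eq_abs, abs_mul]
    have h1 := hK (t - u) (t + u)
    have h2 : |t - u - (t + u)| = 2 * |u| := by
      rw [show t - u - (t + u) = -(2 * u) by ring, abs_neg, abs_mul, abs_two]
    have hK0 : 0 ≤ K := by simpa using (abs_nonneg _).trans (hK 1 0)
    rw [h2] at h1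
    calc _ ≤ |u|⁻¹ * (K * (2 * |u|)) := by
          gcongr
          exact abs_truncInv_le δ u
      _ = 2 * K * (|u|⁻¹ * |u|) := by ring
      _ ≤ 2 * K * 1 := by gcongr; exact inv_mul_le_one
      _ = _ := mul_one _
  have hz : ∀ u ∉ Set.Icc (-(L + T)) (L + T),
      truncInv δ u * (f (t - u) - f (t + u)) = 0 := fun u hu => by
    have hu' : L + T < |u| := by
      by_contra! h
      exact hu (abs_le.1 h)
    rw [hL, hL, sub_zero, mul_zero]
    · have := abs_sub_abs_le_abs_sub u (-t)
      rw [abs_neg, sub_neg_eq_add, add_comm u] at this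
      linarith
    · have := abs_sub_abs_le_abs_sub u t
      rw [abs_sub_comm u] at this
      linarith
  have h := norm_setIntegral_le_of_norm_le_const (μ := volume)
    (by simp) hb
  rw [setIntegral_eq_integral_of_forall_compl_eq_zero hz, ← two_mul_truncated_integral hf hδ,
    Real.norm_eq_abs, abs_mul, abs_two, Real.volume_real_Icc_of_le (by linarith)] at h
  linarith

theorem abs_truncated_integral_sub_le {f : ℝ → ℝ} {K L T δ t h μ : ℝ} (hf : Integrable f)
    (hK : ∀ x y, |f x - f y| ≤ K * |x - y|) (hL : ∀ x, L < |x| → f x = 0)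
    (hδ : 0 < δ) (h0 : 0 ≤ μ) (h1 : μ < 1) (ht : |t| ≤ T) (hth : |t + h| ≤ T) :
    |(∫ s in {s : ℝ | δ < |t + h - s|}, f s / (t + h - s)) -
      ∫ s in {s : ℝ | δ < |t - s|}, f s / (t - s)| ≤
    2 * K * |h| ^ μ * ∫ u in Set.Icc (-(L + T)) (L + T), |u| ^ (-μ) := by
  have hK0 : 0 ≤ K := by simpa using (abs_nonneg _).trans (hK 1 0)
  have i1 := integrable_truncInv_mul ((hf.comp_sub_left (t + h)).sub (hf.comp_add_left (t + h))) hδ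
  have i2 := integrable_truncInv_mul ((hf.comp_sub_left t).sub (hf.comp_add_left t)) hδ
  have e := integral_sub i1 i2
  simp only [Pi.sub_apply] at e
  rw [← two_mul_truncated_integral hf hδ, ← two_mul_truncated_integral hf hδ] at e
  have hz : ∀ s, |s| ≤ T → ∀ u ∉ Set.Icc (-(L + T)) (L + T), f (s - u) - f (s + u) = 0 :=
    fun s hs u hu => by
    have hu' : L + T < |u| := by
      by_contra! h
      exact hu (abs_le.1 h)
    rw [hL, hL, sub_zero]
    · have := abs_sub_abs_le_abs_sub u (-s)
      rw [abs_neg, sub_neg_eq_add, add_comm u] at this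
      linarith
    · have := abs_sub_abs_le_abs_sub u s
      rw [abs_sub_comm u] at this
      linarith
  rw [← setIntegral_eq_integral_of_forall_compl_eq_zero (s := Set.Icc (-(L + T)) (L + T))
    (fun u hu => by rw [hz _ ht u hu, hz _ hth u hu, sub_self])] at e
  have hb : ∀ u : ℝ, ‖truncInv δ u * (f (t + h - u) - f (t + h + u)) -
      truncInv δ u * (f (t - u) - f (t + u))‖ ≤ 4 * K * |h| ^ μ * |u| ^ (-μ) := fun u => by
    rw [← mul_sub, Real.norm_eq_abs, abs_mul]
    rcases eq_or_ne u 0 with rfl | hu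
    · simp only [sub_zero, add_zero, sub_self, abs_zero, mul_zero]
      positivity
    have hu := abs_pos.2 hu
    have a1 : ∀ s, |f (s - u) - f (s + u)| ≤ K * (2 * |u|) := fun s => by
      refine (hK _ _).trans_eq ?_
      rw [show s - u - (s + u) = -(2 * u) by ring, abs_neg, abs_mul, abs_two]
    have a2 := hK (t + h - u) (t - u)
    have a3 := hK (t + h + u) (t + u)
    rw [show t + h - u - (t - u) = h by ring] at a2
    rw [show t + h + u - (t + u) = h by ring] at a3
    have a4 := a1 (t + h)
    have a5 := a1 t
    have b1 : |f (t + h - u) - f (t + h + u) - (f (t - u) - f (t + u))| ≤ 4 * K * |u| := by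
      rw [abs_le] at *
      constructor <;> linarith [a4.1, a4.2, a5.1, a5.2]
    have hKh : 0 ≤ K * |h| := by positivity
    have b2 : |f (t + h - u) - f (t + h + u) - (f (t - u) - f (t + u))| ≤ 4 * K * |h| := by
      rw [abs_le (b := K * |h|)] at a2 a3
      rw [abs_le]
      constructor <;> linarith [a2.1, a2.2, a3.1, a3.2]
    have b3 : |f (t + h - u) - f (t + h + u) - (f (t - u) - f (t + u))| ≤
        4 * K * |u| * min 1 (|h| / |u|) := by
      rcases le_total 1 (|h| / |u|) with hh | hh
      · rwa [min_eq_left hh, mul_one]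
      · rw [min_eq_right hh]
        refine b2.trans_eq ?_
        field_simp
    calc _ ≤ |u|⁻¹ * (4 * K * |u| * (|h| / |u|) ^ μ) := by
          gcongr
          · exact abs_truncInv_le δ u
          · exact b3.trans (by gcongr; exact min_one_le_rpow (by positivity) h0 h1.le)
      _ = 4 * K * (|h| / |u|) ^ μ := by field_simp
      _ = _ := by
          rw [Real.div_rpow (abs_nonneg _) (abs_nonneg _), Real.rpow_neg (abs_nonneg _)]
          ring
  have hn := norm_integral_le_of_norm_le
    ((integrableOn_abs_rpow_neg h1 (L + T)).const_mul (4 * K * |h| ^ μ)) (ae_of_all _ hb)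
  rw [e, ← mul_sub, integral_const_mul, Real.norm_eq_abs, abs_mul, abs_two] at hn
  linarith

section HilbertTransform

variable {f Hf : ℝ → ℝ} {K L : ℝ}

theorem pi_mul_eq_integral_of_tendsto_truncated
    (hL : ∀ x, L < |x| → f x = 0)
    (hHf : ∀ t : ℝ, Tendsto
      (fun δ : ℝ => ∫ s in {s : ℝ | δ < |t - s|}, f s / (t - s))
      (𝓝[>] (0:ℝ)) (𝓝 (Real.pi * Hf t))) {t : ℝ} (ht : L + 1 ≤ |t|) :
    Real.pi * Hf t = ∫ s, f s / (t - s) := by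
  refine tendsto_nhds_unique (hHf t) (tendsto_const_nhds.congr' ?_)
  filter_upwards [Ioo_mem_nhdsGT (zero_lt_one' ℝ)] with δ hδ
  refine (setIntegral_eq_integral_of_forall_compl_eq_zero fun s hs => ?_).symm
  have h1 : |t - s| ≤ δ := not_lt.1 hs
  have h2 := abs_sub_abs_le_abs_sub t s
  rw [hL s (by linarith [hδ.2]), zero_div]

theorem half_abs_le_abs_sub {t s h : ℝ} (ht : 2 * L + 2 ≤ |t|) (hs : |s| ≤ L)
    (hh : |h| ≤ 1) : |t| / 2 ≤ |t + h - s| := by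
  have h1 := abs_sub_abs_le_abs_sub t (s - h)
  have h2 := abs_sub s h
  rw [show t - (s - h) = t + h - s by ring] at h1
  linarith

theorem one_add_sq_le_of_two_le_abs {t : ℝ} (ht : 2 ≤ |t|) : 1 + t ^ 2 ≤ 2 * |t| ^ 2 := by
  rw [← sq_abs t]
  nlinarith

theorem integrable_div_sub (hf : Integrable f) (hL0 : 0 ≤ L) (hL : ∀ x, L < |x| → f x = 0)
    {t h : ℝ} (ht : 2 * L + 2 ≤ |t|) (hh : |h| ≤ 1) : Integrable (fun s => f s / (t + h - s)) := by
  refine hf.mono ?_ (ae_of_all _ fun s => ?_)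
  · have h5 : AEStronglyMeasurable (fun s : ℝ => (t + h - s)⁻¹) :=
      (measurable_const.sub measurable_id).inv.aestronglyMeasurable
    simpa only [div_eq_mul_inv] using hf.aestronglyMeasurable.fun_mul h5
  · by_cases hs : L < |s|
    · simp [hL s hs]
    have h1 := half_abs_le_abs_sub ht (not_lt.1 hs) hh
    rw [norm_div]
    exact div_le_self (norm_nonneg _) (by rw [Real.norm_eq_abs]; linarith)

theorem abs_hilbert_le_of_large (hf : Integrable f) (hf0 : ∫ s, f s = 0) (hL0 : 0 ≤ L)
    (hL : ∀ x, L < |x| → f x = 0)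
    (hHf : ∀ t : ℝ, Tendsto
      (fun δ : ℝ => ∫ s in {s : ℝ | δ < |t - s|}, f s / (t - s))
      (𝓝[>] (0:ℝ)) (𝓝 (Real.pi * Hf t))) {t : ℝ} (ht : 2 * L + 2 ≤ |t|) :
    |Real.pi * Hf t| ≤ 4 * L * (∫ s, |f s|) / (1 + t ^ 2) := by
  have ht2 : 2 ≤ |t| := by linarith
  have ht0 : t ≠ 0 := abs_pos.1 (by linarith)
  have key : ∀ s, |f s / (t - s) - f s / t| ≤ 4 * L / (1 + t ^ 2) * |f s| := fun s => by
    by_cases hs : L < |s|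
    · simp [hL s hs]
    push Not at hs
    have h1 := half_abs_le_abs_sub ht hs (h := 0) (by simp)
    rw [add_zero] at h1
    have hts : t - s ≠ 0 := abs_pos.1 (by linarith)
    have e : f s / (t - s) - f s / t = f s * s / (t * (t - s)) := by field_simp; ring
    rw [e, abs_div, abs_mul, abs_mul]
    calc _ ≤ |f s| * L / (|t| * (|t| / 2)) := by gcongr
      _ = 4 * L / (2 * |t| ^ 2) * |f s| := by field_simp; ring
      _ ≤ _ := by
        gcongr
        exact one_add_sq_le_of_two_le_abs ht2
  have i2 : Integrable (fun s => f s / t) := hf.div_const t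
  have i3 := hf.abs.const_mul (4 * L / (1 + t ^ 2))
  have i1 := integrable_div_sub hf hL0 hL ht (h := 0) (by simp)
  simp only [add_zero] at i1
  have h := norm_integral_le_of_norm_le (f := fun s => f s / (t - s) - f s / t) i3
    (ae_of_all _ key)
  rw [integral_sub i1 i2, integral_div, hf0, zero_div, sub_zero, integral_const_mul,
    ← pi_mul_eq_integral_of_tendsto_truncated hL hHf (by linarith), Real.norm_eq_abs] at h
  exact h.trans_eq (by ring)

theorem abs_hilbert_sub_le_of_large (hf : Integrable f) (hL0 : 0 ≤ L)
    (hL : ∀ x, L < |x| → f x = 0)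
    (hHf : ∀ t : ℝ, Tendsto
      (fun δ : ℝ => ∫ s in {s : ℝ | δ < |t - s|}, f s / (t - s))
      (𝓝[>] (0:ℝ)) (𝓝 (Real.pi * Hf t))) {t h : ℝ} (ht : 2 * L + 2 ≤ |t|) (hh : |h| ≤ 1) :
    |Real.pi * Hf (t + h) - Real.pi * Hf t| ≤ 8 * (∫ s, |f s|) / (1 + t ^ 2) * |h| := by
  have ht2 : 2 ≤ |t| := by linarith
  have key : ∀ s, |f s / (t + h - s) - f s / (t - s)| ≤ 8 / (1 + t ^ 2) * |h| * |f s| :=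
    fun s => by
    by_cases hs : L < |s|
    · simp [hL s hs]
    push Not at hs
    have h1 := half_abs_le_abs_sub ht hs (h := 0) (by simp)
    have h2 := half_abs_le_abs_sub ht hs hh
    rw [add_zero] at h1
    have hts : t - s ≠ 0 := abs_pos.1 (by linarith)
    have hths : t + h - s ≠ 0 := abs_pos.1 (by linarith)
    have e : f s / (t + h - s) - f s / (t - s) = f s * (-h) / ((t + h - s) * (t - s)) := by
      field_simp; ring
    rw [e, abs_div, abs_mul, abs_mul, abs_neg]
    calc _ ≤ |f s| * |h| / ((|t| / 2) * (|t| / 2)) := by gcongr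
      _ = 8 / (2 * |t| ^ 2) * |h| * |f s| := by field_simp; ring
      _ ≤ _ := by
        gcongr
        exact one_add_sq_le_of_two_le_abs ht2
  have i1 := integrable_div_sub hf hL0 hL ht hh
  have i2 := integrable_div_sub hf hL0 hL ht (h := 0) (by simp)
  simp only [add_zero] at i2
  have hn := norm_integral_le_of_norm_le (f := fun s => f s / (t + h - s) - f s / (t - s))
    (hf.abs.const_mul (8 / (1 + t ^ 2) * |h|)) (ae_of_all _ key)
  have hth : |t| - 1 ≤ |t + h| := by
    have h3 := abs_sub_abs_le_abs_sub t (-h)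
    rw [abs_neg, sub_neg_eq_add] at h3
    linarith
  rw [integral_sub i1 i2, integral_const_mul,
    ← pi_mul_eq_integral_of_tendsto_truncated hL hHf (by linarith),
    ← pi_mul_eq_integral_of_tendsto_truncated hL hHf (by linarith), Real.norm_eq_abs] at hn
  exact hn.trans_eq (by ring)

theorem exists_abs_hilbert_le (hf : Integrable f) (hf0 : ∫ s, f s = 0)
    (hK : ∀ x y, |f x - f y| ≤ K * |x - y|) (hL0 : 0 ≤ L) (hL : ∀ x, L < |x| → f x = 0)
    (hHf : ∀ t : ℝ, Tendsto
      (fun δ : ℝ => ∫ s in {s : ℝ | δ < |t - s|}, f s / (t - s))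
      (𝓝[>] (0:ℝ)) (𝓝 (Real.pi * Hf t))) :
    ∃ A, 0 ≤ A ∧ ∀ t, |Hf t| ≤ A * (1 + t ^ 2)⁻¹ := by
  have hK0 : 0 ≤ K := by simpa using (abs_nonneg _).trans (hK 1 0)
  have hI : 0 ≤ ∫ s, |f s| := integral_nonneg fun s => abs_nonneg _
  set T := 2 * L + 2 with hT
  refine ⟨(2 * K * (L + T) * (1 + T ^ 2) + 4 * L * ∫ s, |f s|) / Real.pi, by positivity,
    fun t => ?_⟩
  rw [div_mul_eq_mul_div, le_div_iff₀ Real.pi_pos, ← div_eq_mul_inv,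
    show |Hf t| * Real.pi = |Real.pi * Hf t| by rw [abs_mul, abs_of_pos Real.pi_pos, mul_comm]]
  rcases le_total |t| T with h | h
  · have h1 : |Real.pi * Hf t| ≤ 2 * K * (L + T) :=
      le_of_tendsto (hHf t).abs (eventually_mem_nhdsWithin.mono fun δ hδ =>
        abs_truncated_integral_le hf hK hL hδ (by positivity) h)
    rw [le_div_iff₀ (by positivity)]
    have h2 : t ^ 2 ≤ T ^ 2 := sq_le_sq' (abs_le.1 h).1 (abs_le.1 h).2
    calc _ ≤ 2 * K * (L + T) * (1 + T ^ 2) := by gcongr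
      _ ≤ _ := by linarith [mul_nonneg (mul_nonneg zero_le_four hL0) hI]
  · refine (abs_hilbert_le_of_large hf hf0 hL0 hL hHf h).trans ?_
    gcongr
    have : 0 ≤ 2 * K * (L + T) * (1 + T ^ 2) := by positivity
    linarith

theorem exists_abs_hilbert_sub_le {μ : ℝ} (h0 : 0 ≤ μ) (h1 : μ < 1) (hf : Integrable f)
    (hK : ∀ x y, |f x - f y| ≤ K * |x - y|) (hL0 : 0 ≤ L) (hL : ∀ x, L < |x| → f x = 0)
    (hHf : ∀ t : ℝ, Tendsto
      (fun δ : ℝ => ∫ s in {s : ℝ | δ < |t - s|}, f s / (t - s))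
      (𝓝[>] (0:ℝ)) (𝓝 (Real.pi * Hf t))) :
    ∃ A, 0 ≤ A ∧ ∀ t h, |h| ≤ 1 → |Hf (t + h) - Hf t| ≤ A * |h| ^ μ * (1 + t ^ 2)⁻¹ := by
  have hK0 : 0 ≤ K := by simpa using (abs_nonneg _).trans (hK 1 0)
  have hI : 0 ≤ ∫ s, |f s| := integral_nonneg fun s => abs_nonneg _
  set T := 2 * L + 2 with hT
  set J := ∫ u in Set.Icc (-(L + (T + 1))) (L + (T + 1)), |u| ^ (-μ) with hJ
  have hJ0 : 0 ≤ J := integral_nonneg fun s => by positivity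
  refine ⟨(2 * K * J * (1 + T ^ 2) + 8 * ∫ s, |f s|) / Real.pi, by positivity,
    fun t h hh => ?_⟩
  rw [div_mul_eq_mul_div, div_mul_eq_mul_div, le_div_iff₀ Real.pi_pos, ← div_eq_mul_inv,
    show |Hf (t + h) - Hf t| * Real.pi = |Real.pi * Hf (t + h) - Real.pi * Hf t| by
      rw [← mul_sub, abs_mul, abs_of_pos Real.pi_pos, mul_comm]]
  rcases le_total |t| T with ht | ht
  · have h1 : |Real.pi * Hf (t + h) - Real.pi * Hf t| ≤ 2 * K * |h| ^ μ * J :=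
      le_of_tendsto ((hHf (t + h)).sub (hHf t)).abs (eventually_mem_nhdsWithin.mono fun δ hδ =>
        abs_truncated_integral_sub_le hf hK hL hδ h0 h1 (by linarith)
          ((abs_add_le _ _).trans (by linarith)))
    rw [le_div_iff₀ (by positivity)]
    have h2 : t ^ 2 ≤ T ^ 2 := sq_le_sq' (abs_le.1 ht).1 (abs_le.1 ht).2
    calc _ ≤ 2 * K * |h| ^ μ * J * (1 + T ^ 2) := by gcongr
      _ = 2 * K * J * (1 + T ^ 2) * |h| ^ μ := by ring
      _ ≤ _ := by
        gcongr
        linarith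
  · calc _ ≤ 8 * (∫ s, |f s|) / (1 + t ^ 2) * |h| :=
          abs_hilbert_sub_le_of_large hf hL0 hL hHf ht hh
      _ ≤ 8 * (∫ s, |f s|) / (1 + t ^ 2) * |h| ^ μ := by
          gcongr
          exact Real.self_le_rpow_of_le_one (abs_nonneg _) hh h1.le
      _ = 8 * (∫ s, |f s|) * |h| ^ μ / (1 + t ^ 2) := by ring
      _ ≤ _ := by
          gcongr
          have : 0 ≤ 2 * K * J * (1 + T ^ 2) := by positivity
          linarith

end HilbertTransform

theorem abs_integral_le_of_shell {F : ℝ → ℝ} {c p ρ M : ℝ} (hc : 0 < c) (hρ : 0 ≤ ρ)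
    (hF : ∀ ν, |F ν| ≤ M) (hz : ∀ ν, ρ < |p - c * ν ^ 2| → F ν = 0) :
    |∫ ν, F ν| ≤ M * (2 * √(2 * ρ / c)) := by
  set s := √((p - ρ) / c) with hs
  set l := √(2 * ρ / c) with hl
  have hl0 : 0 ≤ l := Real.sqrt_nonneg _
  have hs0 : 0 ≤ s := Real.sqrt_nonneg _
  have hM : 0 ≤ M := (abs_nonneg _).trans (hF 0)
  have hsl : ∀ ν : ℝ, |p - c * ν ^ 2| ≤ ρ → s ≤ |ν| ∧ |ν| ≤ s + l := fun ν hν => by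
    obtain ⟨h1, h2⟩ := abs_le.1 hν
    constructor
    · refine Real.sqrt_le_iff.2 ⟨abs_nonneg _, ?_⟩
      rw [sq_abs, div_le_iff₀ hc]
      linarith
    · refine abs_le_of_sq_le_sq' ?_ (by positivity) |>.2
      have e1 : (p - ρ) / c ≤ s ^ 2 := by
        rw [hs, Real.sq_sqrt']
        exact le_max_left _ _
      have e2 : l ^ 2 = 2 * ρ / c := Real.sq_sqrt (by positivity)
      have e3 : ν ^ 2 ≤ (p - ρ) / c + 2 * ρ / c := by
        rw [← add_div, le_div_iff₀ hc]
        linarith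
      rw [sq_abs]
      nlinarith [mul_nonneg hs0 hl0]
  have hz' : ∀ ν ∉ Set.Icc (-(s + l)) (-s) ∪ Set.Icc s (s + l), F ν = 0 := fun ν hν => by
    by_contra hne
    obtain ⟨h1, h2⟩ := hsl ν (not_lt.1 fun h => hne (hz ν h))
    refine hν ?_
    rcases abs_cases ν with ⟨h, _⟩ | ⟨h, _⟩ <;> rw [h] at h1 h2
    · exact Or.inr ⟨h1, h2⟩
    · exact Or.inl ⟨by linarith, by linarith⟩
  rw [← setIntegral_eq_integral_of_forall_compl_eq_zero hz', ← Real.norm_eq_abs]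
  refine (norm_setIntegral_le_of_norm_le_const (C := M) ?_ fun ν _ => hF ν).trans ?_
  · exact measure_union_lt_top (by simp) (by simp)
  · gcongr
    refine (measureReal_union_le _ _).trans ?_
    rw [Real.volume_real_Icc_of_le (by linarith), Real.volume_real_Icc_of_le (by linarith)]
    linarith

section Smear

variable {w b b' : ℝ → ℝ} {c r β N K p : ℝ}

theorem inner_integral_eq_zero {v x : ℝ} (hw : ∀ x, r < |x| → w x = 0) (hv : |v| ≤ β)
    (hx : r + β < |x|) : ∫ t in (0:ℝ)..v, w (x - t) = 0 := by
  have h : Set.EqOn (fun t => w (x - t)) (fun _ => 0) (Set.uIcc 0 v) := fun t ht => by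
    have h1 : |t| ≤ |v| := by simpa using Set.abs_sub_left_of_mem_uIcc ht
    have h2 := abs_sub_abs_le_abs_sub x t
    exact hw _ (by linarith)
  rw [intervalIntegral.integral_congr h, intervalIntegral.integral_zero]

theorem continuous_inner_integral (hwc : Continuous w) (hb : Continuous b) (c p : ℝ) :
    Continuous fun ν => ∫ t in (0:ℝ)..b ν, w (p - c * ν ^ 2 - t) :=
  intervalIntegral.continuous_parametric_intervalIntegral_of_continuous
    (f := fun ν t => w (p - c * ν ^ 2 - t)) (by fun_prop) hb

theorem integrable_inner_integral (hc : 0 < c) (hwc : Continuous w)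
    (hw : ∀ x, r < |x| → w x = 0) (hb : Continuous b) (hbβ : ∀ ν, |b ν| ≤ β) (p : ℝ) :
    Integrable fun ν => ∫ t in (0:ℝ)..b ν, w (p - c * ν ^ 2 - t) := by
  refine (continuous_inner_integral hwc hb c p).integrable_of_hasCompactSupport
    (HasCompactSupport.intro (isCompact_closedBall (0:ℝ) √((|p| + r + β) / c)) fun ν hν => ?_)
  refine inner_integral_eq_zero hw (hbβ ν) ?_
  rw [Metric.mem_closedBall, dist_zero_right, Real.norm_eq_abs, not_le,
    Real.sqrt_lt' (lt_of_le_of_ne (abs_nonneg _) fun h => by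
      rw [← h] at hν
      exact absurd hν (not_lt.2 (Real.sqrt_nonneg _))), sq_abs, div_lt_iff₀ hc] at hν
  have h1 := abs_sub_abs_le_abs_sub (c * ν ^ 2) p
  rw [abs_sub_comm, abs_of_nonneg (a := c * ν ^ 2) (by positivity)] at h1
  linarith

theorem abs_smear_sub_le_of_abs_sub_le {η : ℝ} (hc : 0 < c) (hr : 0 ≤ r) (hwc : Continuous w)
    (hN : ∀ x, |w x| ≤ N)
    (hw : ∀ x, r < |x| → w x = 0) (hb : Continuous b) (hbβ : ∀ ν, |b ν| ≤ β)
    (hb' : Continuous b') (hbβ' : ∀ ν, |b' ν| ≤ β) (h : ∀ ν, |b ν - b' ν| ≤ η) :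
    |(∫ ν, ∫ t in (0:ℝ)..b ν, w (p - c * ν ^ 2 - t)) -
      ∫ ν, ∫ t in (0:ℝ)..b' ν, w (p - c * ν ^ 2 - t)| ≤
      N * η * (2 * √(2 * (r + β) / c)) := by
  have hβ : 0 ≤ β := (abs_nonneg _).trans (hbβ 0)
  have hN0 : 0 ≤ N := (abs_nonneg _).trans (hN 0)
  rw [← integral_sub (integrable_inner_integral hc hwc hw hb hbβ p)
    (integrable_inner_integral hc hwc hw hb' hbβ' p)]
  refine abs_integral_le_of_shell (p := p) hc (by positivity) (fun ν => ?_) fun ν hν => ?_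
  · have hi : ∀ x y, IntervalIntegrable (fun t => w (p - c * ν ^ 2 - t)) volume x y :=
      fun x y => Continuous.intervalIntegrable (by fun_prop) _ _
    rw [intervalIntegral.integral_interval_sub_left (hi _ _) (hi _ _)]
    refine (intervalIntegral.norm_integral_le_of_norm_le_const
      (f := fun t => w (p - c * ν ^ 2 - t)) (C := N) fun t _ => hN _).trans ?_
    gcongr
    exact h ν
  · rw [inner_integral_eq_zero hw (hbβ ν) hν, inner_integral_eq_zero hw (hbβ' ν) hν, sub_zero]

theorem abs_smear_le (hc : 0 < c) (hr : 0 ≤ r) (hwc : Continuous w)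
    (hN : ∀ x, |w x| ≤ N)
    (hw : ∀ x, r < |x| → w x = 0) (hb : Continuous b) (hbβ : ∀ ν, |b ν| ≤ β) :
    |∫ ν, ∫ t in (0:ℝ)..b ν, w (p - c * ν ^ 2 - t)| ≤ N * β * (2 * √(2 * (r + β) / c)) := by
  have hβ : 0 ≤ β := (abs_nonneg _).trans (hbβ 0)
  have h := abs_smear_sub_le_of_abs_sub_le (p := p) (b' := fun _ => 0) (η := β) hc hr hwc hN hw
    hb hbβ continuous_const (by simpa using hβ) (by simpa using hbβ)
  simpa using h

theorem abs_smear_add_sub_le {d : ℝ} (hc : 0 < c) (hr : 0 ≤ r) (hwc : Continuous w)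
    (hK : ∀ x y, |w x - w y| ≤ K * |x - y|)
    (hw : ∀ x, r < |x| → w x = 0) (hb : Continuous b) (hbβ : ∀ ν, |b ν| ≤ β) (hd : |d| ≤ 1) :
    |(∫ ν, ∫ t in (0:ℝ)..b ν, w (p + d - c * ν ^ 2 - t)) -
      ∫ ν, ∫ t in (0:ℝ)..b ν, w (p - c * ν ^ 2 - t)| ≤
      K * |d| * β * (2 * √(2 * (r + β + 1) / c)) := by
  have hβ : 0 ≤ β := (abs_nonneg _).trans (hbβ 0)
  have hK0 : 0 ≤ K := by simpa using (abs_nonneg _).trans (hK 1 0)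
  rw [← integral_sub (integrable_inner_integral hc hwc hw hb hbβ (p + d))
    (integrable_inner_integral hc hwc hw hb hbβ p)]
  refine abs_integral_le_of_shell (p := p) hc (by positivity) (fun ν => ?_) fun ν hν => ?_
  · rw [← intervalIntegral.integral_sub (Continuous.intervalIntegrable (by fun_prop) _ _)
      (Continuous.intervalIntegrable (by fun_prop) _ _)]
    refine (intervalIntegral.norm_integral_le_of_norm_le_const
      (f := fun t => w (p + d - c * ν ^ 2 - t) - w (p - c * ν ^ 2 - t)) (C := K * |d|) fun t _ => ?_).trans ?_
    · refine (hK _ _).trans_eq ?_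
      congr 2
      ring
    · gcongr
      simpa using hbβ ν
  · have h1 := abs_sub_abs_le_abs_sub (p - c * ν ^ 2) (-d)
    rw [abs_neg, sub_neg_eq_add, show p - c * ν ^ 2 + d = p + d - c * ν ^ 2 by ring] at h1
    rw [inner_integral_eq_zero hw (hbβ ν) (by linarith),
      inner_integral_eq_zero hw (hbβ ν) (by linarith), sub_zero]

end Smear

theorem continuous_of_abs_sub_le_rpow {b : ℝ → ℝ} {c γ : ℝ} (hγ : 0 < γ)
    (hb : ∀ x h, |b (x + h) - b x| ≤ c * |h| ^ γ) : Continuous b := by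
  refine continuous_iff_continuousAt.2 fun x => ?_
  rw [ContinuousAt, tendsto_iff_norm_sub_tendsto_zero]
  have hc : Continuous fun y : ℝ => c * |y - x| ^ γ :=
    continuous_const.mul ((by fun_prop : Continuous fun y : ℝ => |y - x|).rpow_const
      fun _ => Or.inr hγ.le)
  refine squeeze_zero (fun _ => norm_nonneg _) (fun y => ?_)
    (by simpa [Real.zero_rpow hγ.ne'] using hc.tendsto x)
  simpa using hb x (y - x)

theorem summable_inv_one_add_int_sq : Summable fun j : ℤ => (1 + (j:ℝ) ^ 2)⁻¹ := by
  refine Summable.of_norm_bounded_eventually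
    (Real.summable_one_div_int_pow.2 (one_lt_two : 1 < 2)) ?_
  filter_upwards [(Set.finite_singleton (0:ℤ)).compl_mem_cofinite] with j hj
  have : (j:ℝ) ≠ 0 := by exact_mod_cast hj
  rw [Real.norm_of_nonneg (by positivity), one_div]
  gcongr
  linarith

theorem inv_one_add_sub_sq_le {P p : ℝ} (hp : |p| ≤ P) (j : ℝ) :
    (1 + (p - j) ^ 2)⁻¹ ≤ 2 * (1 + P ^ 2) * (1 + j ^ 2)⁻¹ := by
  rw [← div_eq_mul_inv, inv_le_comm₀ (by positivity) (by positivity), inv_div,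
    div_le_iff₀ (by positivity)]
  have h : p ^ 2 ≤ P ^ 2 := sq_le_sq' (abs_le.1 hp).1 (abs_le.1 hp).2
  nlinarith [sq_nonneg (2 * p - j), mul_nonneg (sq_nonneg P) (sq_nonneg (p - j)),
    sq_nonneg (p - j)]

theorem summable_of_abs_le_inv_one_add_sub_sq {u : ℤ → ℝ} {C p : ℝ}
    (h : ∀ j : ℤ, |u j| ≤ C * (1 + (p - j) ^ 2)⁻¹) : Summable u := by
  have hC : 0 ≤ C := nonneg_of_mul_nonneg_left ((abs_nonneg _).trans (h 0)) (by positivity)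
  exact Summable.of_norm_bounded
    ((summable_inv_one_add_int_sq.mul_left (2 * (1 + |p| ^ 2))).mul_left C) fun j =>
      (h j).trans (mul_le_mul_of_nonneg_left (inv_one_add_sub_sq_le le_rfl _) hC)

theorem abs_tsum_sub_tsum_le {u v : ℤ → ℝ} {C P p : ℝ} (hp : |p| ≤ P)
    (hu : Summable u) (hv : Summable v)
    (h : ∀ j : ℤ, |u j - v j| ≤ C * (1 + (p - j) ^ 2)⁻¹) :
    |∑' j, u j - ∑' j, v j| ≤ C * (2 * (1 + P ^ 2) * ∑' j : ℤ, (1 + (j:ℝ) ^ 2)⁻¹) := by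
  have hC : 0 ≤ C := nonneg_of_mul_nonneg_left ((abs_nonneg _).trans (h 0)) (by positivity)
  rw [← hu.tsum_sub hv]
  exact tsum_of_norm_bounded (f := fun j => u j - v j)
    ((summable_inv_one_add_int_sq.hasSum.mul_left (2 * (1 + P ^ 2))).mul_left C) fun j =>
      (h j).trans (mul_le_mul_of_nonneg_left (inv_one_add_sub_sq_le hp _) hC)

theorem HasCompactSupport.exists_forall_lt_abs_eq_zero {f : ℝ → ℝ} (hf : HasCompactSupport f) :
    ∃ L, 0 ≤ L ∧ ∀ x, L < |x| → f x = 0 := by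
  obtain ⟨L, hL⟩ := hf.isCompact.isBounded.subset_closedBall 0
  refine ⟨max L 0, le_max_right _ _, fun x hx => image_eq_zero_of_notMem_tsupport fun h => ?_⟩
  have := hL h
  rw [mem_closedBall_zero_iff, Real.norm_eq_abs] at this
  exact absurd hx (not_lt.2 (this.trans (le_max_left _ _)))

/-- continuity moduli of
`Ψ_l(αt,p̂,q) = Σ_{j∈ℤ} (𝓗 ik')(p̂−j) g_l(ε^{1/2}αt, j−q)`: for any fixed
`μ ∈ (0,1)` and bounded sets `B_p, B_q ⊂ ℝ`, uniformly in
`αt ∈ ε^{−1/2}(−a,a)`, `p̂ ∈ B_p`, `q ∈ B_q` and sufficiently small `ε > 0`,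
the increments in `αt`, `p̂`, `q` are `O(|Δαt|^γ)`, `O(|Δp̂|^μ)`, `O(|Δq|)`. -/
theorem stmt_5 (γ a c₀ ε₀ D R₀ μ : ℝ) (Bp Bq : Set ℝ) (w ik Hikp : ℝ → ℝ)
    (H : ℝ → ℝ → ℝ)
    (hγ : γ ∈ Set.Ioc (0:ℝ) 1) (ha : 0 < a) (hc₀ : 0 < c₀) (hε₀ : 0 < ε₀)
    (hR₀ : 0 < R₀) (hμ : μ ∈ Set.Ioo (0:ℝ) 1)
    (hBp : Bornology.IsBounded Bp) (hBq : Bornology.IsBounded Bq)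
    -- the detector aperture function w ∈ C₀²(ℝ), even, with ∫ w = 1
    (hw_even : ∀ p : ℝ, w (-p) = w p)
    (hw_supp : HasCompactSupport w)
    (hw_d1 : ∀ p : ℝ, DifferentiableAt ℝ w p)
    (hw_d2 : ∀ p : ℝ, DifferentiableAt ℝ (deriv w) p)
    (hw_bdd : ∃ M : ℝ, ∀ᵐ p : ℝ, |deriv (deriv w) p| ≤ M)
    (hw_int : ∫ p : ℝ, w p = 1)
    -- the interpolation kernel ik ∈ C₀²(ℝ), even, exact up to order 1
    (hik_even : ∀ p : ℝ, ik (-p) = ik p)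
    (hik_supp : HasCompactSupport ik)
    (hik_d1 : ∀ p : ℝ, DifferentiableAt ℝ ik p)
    (hik_d2 : ∀ p : ℝ, DifferentiableAt ℝ (deriv ik) p)
    (hik_bdd : ∃ M : ℝ, ∀ᵐ p : ℝ, |deriv (deriv ik) p| ≤ M)
    (hik_exact0 : ∀ u : ℝ, ∑' j : ℤ, ik (u - (j : ℝ)) = 1)
    (hik_exact1 : ∀ u : ℝ, ∑' j : ℤ, (j : ℝ) * ik (u - (j : ℝ)) = u)
    -- Hikp is the Hilbert transform of ik'
    (hHikp : ∀ t : ℝ, Tendsto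
      (fun δ : ℝ => ∫ s in {s : ℝ | δ < |t - s|}, deriv ik s / (t - s))
      (𝓝[>] (0:ℝ)) (𝓝 (Real.pi * Hikp t)))
    -- the perturbation family: H1 and H2
    (hH1 : ∀ ε ∈ Set.Ioo (0:ℝ) ε₀, ∀ s : ℝ, |H ε s| ≤ c₀ * ε)
    (hH2 : ∀ ε ∈ Set.Ioo (0:ℝ) ε₀, ∀ s h : ℝ, 0 < h →
      |H ε (s + Real.sqrt ε * h) - H ε s| ≤ c₀ * ε * h ^ γ)
    -- the leading term g_l
    (gl : ℝ → ℝ → ℝ → ℝ)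
    (hgl : ∀ ε α p : ℝ, gl ε α p = D * R₀ *
      ∫ ν : ℝ, ∫ t in (0:ℝ)..(ε⁻¹ * H ε (α + Real.sqrt ε * ν)),
        w (p - R₀ / 2 * ν ^ 2 - t))
    -- Ψ_l
    (Psil : ℝ → ℝ → ℝ → ℝ → ℝ)
    (hPsil : ∀ ε αt p q : ℝ, Psil ε αt p q =
      ∑' j : ℤ, Hikp (p - (j : ℝ)) * gl ε (Real.sqrt ε * αt) ((j : ℝ) - q)) :
    ∃ C Δ₀ ε₁ : ℝ, 0 < C ∧ 0 < Δ₀ ∧ 0 < ε₁ ∧ ε₁ ≤ ε₀ ∧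
      ∀ ε ∈ Set.Ioo (0:ℝ) ε₁, ∀ αt : ℝ, |Real.sqrt ε * αt| < a →
        ∀ p ∈ Bp, ∀ q ∈ Bq,
          (∀ dα : ℝ, |dα| ≤ Δ₀ →
            |Psil ε (αt + dα) p q - Psil ε αt p q| ≤ C * |dα| ^ γ) ∧
          (∀ dp : ℝ, |dp| ≤ Δ₀ →
            |Psil ε αt (p + dp) q - Psil ε αt p q| ≤ C * |dp| ^ μ) ∧
          (∀ dq : ℝ, |dq| ≤ Δ₀ →
            |Psil ε αt p (q + dq) - Psil ε αt p q| ≤ C * |dq|) := by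
  obtain ⟨hγ0, hγ1⟩ := hγ
  obtain ⟨hμ0, hμ1⟩ := hμ
  -- the Hilbert transform of `ik'`
  obtain ⟨Mi, hMi⟩ := hik_bdd
  obtain ⟨L, hL0, hL⟩ := hik_supp.deriv.exists_forall_lt_abs_eq_zero
  have hdik : Integrable (deriv ik) :=
    Continuous.integrable_of_hasCompactSupport
      (continuous_iff_continuousAt.2 fun p => (hik_d2 p).continuousAt) hik_supp.deriv
  have hik : Integrable ik := Continuous.integrable_of_hasCompactSupport
      (continuous_iff_continuousAt.2 fun p => (hik_d1 p).continuousAt) hik_supp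
  have hdik0 : ∫ s, deriv ik s = 0 :=
    integral_eq_zero_of_hasDerivAt_of_integrable (fun x => (hik_d1 x).hasDerivAt) hdik hik
  have hdikK := abs_sub_le_of_ae_abs_deriv_le hik_d2 hMi
  obtain ⟨A, hA0, hA⟩ := exists_abs_hilbert_le hdik hdik0 hdikK hL0 hL hHikp
  obtain ⟨A', hA'0, hA'⟩ := exists_abs_hilbert_sub_le hμ0.le hμ1 hdik hdikK hL0 hL hHikp
  -- the aperture function
  obtain ⟨r, hr0, hr⟩ := hw_supp.exists_forall_lt_abs_eq_zero
  have hwc : Continuous w := continuous_iff_continuousAt.2 fun p => (hw_d1 p).continuousAt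
  obtain ⟨N, hN⟩ := hw_supp.exists_bound_of_continuous hwc
  obtain ⟨K, hK⟩ := hw_supp.deriv.exists_bound_of_continuous
    (continuous_iff_continuousAt.2 fun p => (hw_d2 p).continuousAt)
  have hwK := abs_sub_le_of_ae_abs_deriv_le hw_d1 (ae_of_all _ hK)
  have hN0 : 0 ≤ N := (norm_nonneg _).trans (hN 0)
  have hK0 : 0 ≤ K := (norm_nonneg _).trans (hK 0)
  have hc : 0 < R₀ / 2 := by positivity
  obtain ⟨P, hP⟩ := hBp.subset_closedBall 0
  -- the rescaled perturbation `H₀(αt + ν) = ε⁻¹ H_ε(√ε (αt + ν))`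
  have hb1 : ∀ ε ∈ Set.Ioo (0:ℝ) ε₀, ∀ α ν : ℝ,
      |ε⁻¹ * H ε (√ε * α + √ε * ν)| ≤ c₀ := fun ε hε α ν => by
    have := hH1 ε hε (√ε * α + √ε * ν)
    rw [abs_mul, abs_of_pos (inv_pos.2 hε.1), inv_mul_le_iff₀ hε.1]
    linarith
  have hb2 : ∀ ε ∈ Set.Ioo (0:ℝ) ε₀, ∀ s h : ℝ,
      |ε⁻¹ * H ε (s + √ε * h) - ε⁻¹ * H ε s| ≤ c₀ * |h| ^ γ := fun ε hε s h => by
    rw [← mul_sub, abs_mul, abs_of_pos (inv_pos.2 hε.1), inv_mul_le_iff₀ hε.1]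
    rcases lt_trichotomy h 0 with hh | rfl | hh
    · have := hH2 ε hε (s + √ε * h) (-h) (by linarith)
      rw [show s + √ε * h + √ε * -h = s by ring, abs_sub_comm, ← abs_of_neg hh] at this
      linarith
    · simp [Real.zero_rpow hγ0.ne']
    · have := hH2 ε hε s h hh
      rw [abs_of_pos hh]
      linarith
  have hbc : ∀ ε ∈ Set.Ioo (0:ℝ) ε₀, ∀ α : ℝ,
      Continuous fun ν => ε⁻¹ * H ε (√ε * α + √ε * ν) := fun ε hε α =>
    continuous_of_abs_sub_le_rpow hγ0 (c := c₀) fun x h => by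
      rw [mul_add, ← add_assoc]
      exact hb2 ε hε _ h
  -- bounds on `g_l`
  set Z := 2 * √(2 * (r + c₀) / (R₀ / 2)) with hZ
  set Z' := 2 * √(2 * (r + c₀ + 1) / (R₀ / 2)) with hZ'
  have hZ0 : 0 ≤ Z := by positivity
  have hZ'0 : 0 ≤ Z' := by positivity
  have g1 : ∀ ε ∈ Set.Ioo (0:ℝ) ε₀, ∀ α p : ℝ,
      |gl ε (√ε * α) p| ≤ |D * R₀| * (N * c₀ * Z) := fun ε hε α p => by
    rw [hgl, abs_mul]
    gcongr
    exact abs_smear_le hc hr0 hwc hN hr (hbc ε hε α) (hb1 ε hε α)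
  have g2 : ∀ ε ∈ Set.Ioo (0:ℝ) ε₀, ∀ α d p : ℝ,
      |gl ε (√ε * (α + d)) p - gl ε (√ε * α) p| ≤
        |D * R₀| * (N * (c₀ * |d| ^ γ) * Z) := fun ε hε α d p => by
    rw [hgl, hgl, ← mul_sub, abs_mul]
    gcongr
    refine abs_smear_sub_le_of_abs_sub_le hc hr0 hwc hN hr (hbc ε hε _) (hb1 ε hε _)
      (hbc ε hε α) (hb1 ε hε α) fun ν => ?_
    rw [show √ε * (α + d) + √ε * ν = √ε * α + √ε * ν + √ε * d by ring]
    exact hb2 ε hε _ d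
  have g3 : ∀ ε ∈ Set.Ioo (0:ℝ) ε₀, ∀ α d p : ℝ, |d| ≤ 1 →
      |gl ε (√ε * α) (p + d) - gl ε (√ε * α) p| ≤
        |D * R₀| * (K * |d| * c₀ * Z') := fun ε hε α d p hd => by
    rw [hgl, hgl, ← mul_sub, abs_mul]
    gcongr
    exact abs_smear_add_sub_le hc hr0 hwc hwK hr (hbc ε hε α) (hb1 ε hε α) hd
  have hsum : ∀ ε ∈ Set.Ioo (0:ℝ) ε₀, ∀ α p q : ℝ,
      Summable fun j : ℤ => Hikp (p - (j:ℝ)) * gl ε (√ε * α) ((j:ℝ) - q) := fun ε hε α p q =>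
    summable_of_abs_le_inv_one_add_sub_sq (p := p) (C := A * (|D * R₀| * (N * c₀ * Z)))
      fun j => by
        rw [abs_mul, mul_right_comm]
        exact mul_le_mul (hA _) (g1 ε hε _ _) (abs_nonneg _) (by positivity)
  set S := 2 * (1 + P ^ 2) * ∑' j : ℤ, (1 + (j:ℝ) ^ 2)⁻¹ with hS
  have hS0 : 0 ≤ S := mul_nonneg (by positivity) (tsum_nonneg fun j => by positivity)
  set C₁ := A * (|D * R₀| * (N * c₀ * Z)) * S with hC₁
  set C₂ := A' * (|D * R₀| * (N * c₀ * Z)) * S with hC₂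
  set C₃ := A * (|D * R₀| * (K * c₀ * Z')) * S with hC₃
  have hC₁0 : 0 ≤ C₁ := by positivity
  have hC₂0 : 0 ≤ C₂ := by positivity
  have hC₃0 : 0 ≤ C₃ := by positivity
  refine ⟨C₁ + C₂ + C₃ + 1, 1, ε₀, by positivity, one_pos, hε₀, le_rfl,
    fun ε hε α _ p hp q _ => ?_⟩
  have hpP : |p| ≤ P := by simpa using hP hp
  refine ⟨fun d _ => ?_, fun d hd => ?_, fun d hd => ?_⟩
  · rw [hPsil, hPsil]
    calc _ ≤ A * (|D * R₀| * (N * (c₀ * |d| ^ γ) * Z)) * S :=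
          abs_tsum_sub_tsum_le hpP (hsum ε hε _ _ _) (hsum ε hε _ _ _) fun j => by
            rw [← mul_sub, abs_mul, mul_right_comm]
            exact mul_le_mul (hA _) (g2 ε hε _ _ _) (abs_nonneg _) (by positivity)
      _ = C₁ * |d| ^ γ := by ring
      _ ≤ _ := by
          gcongr
          linarith
  · rw [hPsil, hPsil]
    calc _ ≤ A' * |d| ^ μ * (|D * R₀| * (N * c₀ * Z)) * S :=
          abs_tsum_sub_tsum_le hpP (hsum ε hε _ _ _) (hsum ε hε _ _ _) fun j => by
            rw [← sub_mul, abs_mul, mul_right_comm, add_sub_right_comm]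
            exact mul_le_mul (hA' _ _ hd) (g1 ε hε _ _) (abs_nonneg _) (by positivity)
      _ = C₂ * |d| ^ μ := by ring
      _ ≤ _ := by
          gcongr
          linarith
  · rw [hPsil, hPsil]
    calc _ ≤ A * (|D * R₀| * (K * |d| * c₀ * Z')) * S :=
          abs_tsum_sub_tsum_le hpP (hsum ε hε _ _ _) (hsum ε hε _ _ _) fun j => by
            have h := g3 ε hε α (-d) ((j:ℝ) - q) (by rwa [abs_neg])
            rw [abs_neg, ← sub_eq_add_neg, sub_sub] at h
            rw [← mul_sub, abs_mul, mul_right_comm]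
            exact mul_le_mul (hA _) h (abs_nonneg _) (by positivity)
      _ = C₃ * |d| := by ring
      _ ≤ _ := by
          gcongr
          linarith
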